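/- Comparison principle for viscosity solutions under strict monotonicity (Theorem 2.9(a)). Assume the Hamiltonian H = (H^j) satisfies (H0)–(H6) and moreover (Hr): for every j ∈ J, y ∈ [0,l_j] and p ∈ ℝ the map r ↦ H^j(y,r,p) is strictly increasing. Let u₁ be a bounded viscosity supersolution and u₂ a bounded viscosity subsolution of H(x,u,∂u) = 0 on Γ such that u₁(v_i) ≥ u₂(v_i) for all i ∈ I_B. Then u₁ ≥ u₂ everywhere on Γ. -/

import Mathlib

open Set

noncomputable section

/-- A finite connected topological network. -/
structure Network where
  I : Type
  J : Type
  finI : Fintype I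
  finJ : Fintype J
  neI : Nonempty I
  neJ : Nonempty J
  l : J → ℝ
  l_pos : ∀ j, 0 < l j
  s : J → I
  t : J → I
  st_ne : ∀ j, s j ≠ t j
  conn : ∀ i i' : I,
    Relation.ReflTransGen (fun a b => ∃ j, (s j = a ∧ t j = b) ∨ (s j = b ∧ t j = a)) i i'
  IB : Set I
  IB_ne : IB.Nonempty
  deg_one_bd : ∀ i : I, ({j : J | s j = i ∨ t j = i} : Set J).ncard = 1 → i ∈ IB

attribute [instance] Network.finI Network.finJ Network.neI Network.neJ

namespace Network

open scoped Classical

variable (N : Network)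

/-- The set of edges incident to the vertex `i`. -/
def Inc (i : N.I) : Set N.J := {j | N.s j = i ∨ N.t j = i}

/-- The set of transition vertices. -/
def IT : Set N.I := N.IBᶜ

/-- The signed incidence `a_{ij}`. -/
def sgn (i : N.I) (j : N.J) : ℝ := if N.s j = i then 1 else -1

/-- The parameter `y_i^j` of the vertex `i` on the edge `j`. -/
def param (i : N.I) (j : N.J) : ℝ := if N.s j = i then 0 else N.l j

/-- The edge `j` as a parameter interval. -/
def edge (j : N.J) : Set ℝ := Icc 0 (N.l j)

/-- A family `(u^j)` of functions on the edges defines a function on the network iff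
the values at each vertex agree. -/
def Compat (u : N.J → ℝ → ℝ) : Prop :=
  ∀ i : N.I, ∀ j ∈ N.Inc i, ∀ k ∈ N.Inc i, u j (N.param i j) = u k (N.param i k)

/-- `u ∈ C(Γ)`. -/
def IsCont (u : N.J → ℝ → ℝ) : Prop :=
  N.Compat u ∧ ∀ j, ContinuousOn (u j) (N.edge j)

/-- `u ∈ C²(Γ)`. -/
def IsC2 (u : N.J → ℝ → ℝ) : Prop :=
  N.Compat u ∧ ∀ j, ContDiffOn ℝ 2 (u j) (N.edge j)

/-- First derivative `∂_j u` along the edge `j`. -/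
def pd (u : N.J → ℝ → ℝ) (j : N.J) (x : ℝ) : ℝ := derivWithin (u j) (N.edge j) x

/-- Second derivative `∂²_j u` along the edge `j`. -/
def pd2 (u : N.J → ℝ → ℝ) (j : N.J) (x : ℝ) : ℝ := derivWithin (N.pd u j) (N.edge j) x

/-- Sum over the edges incident to `i`. -/
def incSum (i : N.I) (f : N.J → ℝ) : ℝ := ∑ j : N.J, if j ∈ N.Inc i then f j else 0

/-- The Kirchhoff sum `S^i_β u`. -/
def kir (β : N.I → N.J → ℝ) (u : N.J → ℝ → ℝ) (i : N.I) : ℝ :=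
  N.incSum i (fun j => β i j * N.sgn i j * N.pd u j (N.param i j))

/-- `u ∈ C²_{*,β}(Γ)`. -/
def IsC2Star (β : N.I → N.J → ℝ) (u : N.J → ℝ → ℝ) : Prop :=
  N.IsC2 u ∧ ∀ i ∈ N.IT, N.kir β u i = 0

/-- (H0): continuity of each `H^j`. -/
def H0 (H : N.J → ℝ → ℝ → ℝ → ℝ) : Prop :=
  ∀ j, ContinuousOn (fun q : ℝ × ℝ × ℝ => H j q.1 q.2.1 q.2.2)
    ((N.edge j) ×ˢ (univ : Set ℝ) ×ˢ (univ : Set ℝ))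

/-- (H1): `r ↦ H^j(x,r,p)` is nondecreasing. -/
def H1 (H : N.J → ℝ → ℝ → ℝ → ℝ) : Prop :=
  ∀ j, ∀ x ∈ N.edge j, ∀ p : ℝ, Monotone fun r => H j x r p

/-- (H3): `p ↦ H^j(v_i,r,p)` is nondecreasing on `(0,∞)` at transition vertices. -/
def H3 (H : N.J → ℝ → ℝ → ℝ → ℝ) : Prop :=
  ∀ i ∈ N.IT, ∀ j ∈ N.Inc i, ∀ r : ℝ,
    MonotoneOn (fun p => H j (N.param i j) r p) (Ioi (0 : ℝ))

/-- (H4): coercivity in `p`, uniform on bounded `r`-sets. -/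
def H4 (H : N.J → ℝ → ℝ → ℝ → ℝ) : Prop :=
  ∀ j, ∀ R : ℝ, 0 < R → ∀ A : ℝ, ∃ M : ℝ, ∀ x ∈ N.edge j, ∀ r : ℝ, |r| ≤ R →
    ∀ p : ℝ, M < |p| → A < H j x r p

/-- (H5): continuity of `H` at the transition vertices. -/
def H5 (H : N.J → ℝ → ℝ → ℝ → ℝ) : Prop :=
  ∀ i ∈ N.IT, ∀ j ∈ N.Inc i, ∀ k ∈ N.Inc i, ∀ r p : ℝ,
    H j (N.param i j) r p = H k (N.param i k) r p

/-- (H6): symmetry of `H` in `p` at the transition vertices. -/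
def H6 (H : N.J → ℝ → ℝ → ℝ → ℝ) : Prop :=
  ∀ i ∈ N.IT, ∀ j ∈ N.Inc i, ∀ r p : ℝ,
    H j (N.param i j) r p = H j (N.param i j) r (-p)

end Network

namespace Network

variable (N : Network)

/-- `u ∈ USC(Γ)`. -/
def IsUSC (u : N.J → ℝ → ℝ) : Prop :=
  N.Compat u ∧ ∀ j, UpperSemicontinuousOn (u j) (N.edge j)

/-- `u ∈ LSC(Γ)`. -/
def IsLSC (u : N.J → ℝ → ℝ) : Prop :=
  N.Compat u ∧ ∀ j, LowerSemicontinuousOn (u j) (N.edge j)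

/-- `φ` is a `(j,k)`-test function at the transition vertex `i`. -/
def IsTestJK (φ : N.J → ℝ → ℝ) (i : N.I) (j k : N.J) : Prop :=
  N.IsCont φ ∧
  DifferentiableWithinAt ℝ (φ j) (N.edge j) (N.param i j) ∧
  DifferentiableWithinAt ℝ (φ k) (N.edge k) (N.param i k) ∧
  N.sgn i j * N.pd φ j (N.param i j) + N.sgn i k * N.pd φ k (N.param i k) = 0

/-- `w` has a local maximum at the vertex `i` relative to `ē_j ∪ ē_k`. -/
def LocalMaxVertex (w : N.J → ℝ → ℝ) (i : N.I) (j k : N.J) : Prop :=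
  ∃ δ > 0, (∀ x ∈ N.edge j, |x - N.param i j| < δ → w j x ≤ w j (N.param i j)) ∧
           (∀ x ∈ N.edge k, |x - N.param i k| < δ → w k x ≤ w k (N.param i k))

/-- `w` has a local minimum at the vertex `i` relative to `ē_j ∪ ē_k`. -/
def LocalMinVertex (w : N.J → ℝ → ℝ) (i : N.I) (j k : N.J) : Prop :=
  ∃ δ > 0, (∀ x ∈ N.edge j, |x - N.param i j| < δ → w j (N.param i j) ≤ w j x) ∧
           (∀ x ∈ N.edge k, |x - N.param i k| < δ → w k (N.param i k) ≤ w k x)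

/-- `u` is a viscosity subsolution of `H(x,u,∂u) = 0` on `Γ`. -/
def IsSubsol (H : N.J → ℝ → ℝ → ℝ → ℝ) (u : N.J → ℝ → ℝ) : Prop :=
  N.IsUSC u ∧
  (∀ j : N.J, ∀ y ∈ Ioo 0 (N.l j), ∀ φ : N.J → ℝ → ℝ, N.IsCont φ →
    DifferentiableWithinAt ℝ (φ j) (N.edge j) y →
    (∃ δ > 0, ∀ x ∈ N.edge j, |x - y| < δ → u j x - φ j x ≤ u j y - φ j y) →
    H j y (u j y) (N.pd φ j y) ≤ 0) ∧
  (∀ i ∈ N.IT, ∀ j ∈ N.Inc i, ∀ k ∈ N.Inc i, j ≠ k →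
    ∀ φ : N.J → ℝ → ℝ, N.IsTestJK φ i j k →
    N.LocalMaxVertex (fun m x => u m x - φ m x) i j k →
    H j (N.param i j) (u j (N.param i j)) (N.pd φ j (N.param i j)) ≤ 0)

/-- `u` is a viscosity supersolution of `H(x,u,∂u) = 0` on `Γ`. -/
def IsSupersol (H : N.J → ℝ → ℝ → ℝ → ℝ) (u : N.J → ℝ → ℝ) : Prop :=
  N.IsLSC u ∧
  (∀ j : N.J, ∀ y ∈ Ioo 0 (N.l j), ∀ φ : N.J → ℝ → ℝ, N.IsCont φ →
    DifferentiableWithinAt ℝ (φ j) (N.edge j) y →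
    (∃ δ > 0, ∀ x ∈ N.edge j, |x - y| < δ → u j y - φ j y ≤ u j x - φ j x) →
    0 ≤ H j y (u j y) (N.pd φ j y)) ∧
  (∀ i ∈ N.IT, ∀ j ∈ N.Inc i, ∃ k ∈ N.Inc i, k ≠ j ∧
    ∀ φ : N.J → ℝ → ℝ, N.IsTestJK φ i j k →
    N.LocalMinVertex (fun m x => u m x - φ m x) i j k →
    0 ≤ H j (N.param i j) (u j (N.param i j)) (N.pd φ j (N.param i j)))

/-- `u` is a viscosity solution of `H(x,u,∂u) = 0` on `Γ`. -/
def IsViscSol (H : N.J → ℝ → ℝ → ℝ → ℝ) (u : N.J → ℝ → ℝ) : Prop :=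
  N.IsCont u ∧ N.IsSubsol H u ∧ N.IsSupersol H u

end Network

section EdgeProblem

open Filter Topology

/-- `U` is a viscosity subsolution of `G(t,U,U') = 0` on the open interval `(0,l)`. -/
def IsEdgeSubsol (G : ℝ → ℝ → ℝ → ℝ) (l : ℝ) (U : ℝ → ℝ) : Prop :=
  ∀ t ∈ Ioo 0 l, ∀ (ψ : ℝ → ℝ) (p : ℝ),
    ContinuousOn ψ (Icc 0 l) → HasDerivAt ψ p t →
    IsLocalMax (fun x => U x - ψ x) t → G t (U t) p ≤ 0

/-- `V` is a viscosity supersolution of `G(t,V,V') = 0` on the open interval `(0,l)`. -/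
def IsEdgeSupersol (G : ℝ → ℝ → ℝ → ℝ) (l : ℝ) (V : ℝ → ℝ) : Prop :=
  ∀ t ∈ Ioo 0 l, ∀ (ψ : ℝ → ℝ) (p : ℝ),
    ContinuousOn ψ (Icc 0 l) → HasDerivAt ψ p t →
    IsLocalMin (fun x => V x - ψ x) t → 0 ≤ G t (V t) p

/-- Joint continuity of a Hamiltonian on the interval `[0,l]`. -/
def EdgeCont (G : ℝ → ℝ → ℝ → ℝ) (l : ℝ) : Prop :=
  ContinuousOn (fun q : ℝ × ℝ × ℝ => G q.1 q.2.1 q.2.2)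
    (Icc 0 l ×ˢ (univ : Set ℝ) ×ˢ (univ : Set ℝ))

/-- Coercivity of a Hamiltonian on the interval `[0,l]`. -/
def EdgeCoercive (G : ℝ → ℝ → ℝ → ℝ) (l : ℝ) : Prop :=
  ∀ R : ℝ, 0 < R → ∀ A : ℝ, ∃ M : ℝ, ∀ x ∈ Icc 0 l, ∀ r : ℝ, |r| ≤ R →
    ∀ p : ℝ, M < |p| → A < G x r p

lemma EdgeCont.pos_near_compact {G : ℝ → ℝ → ℝ → ℝ} {l : ℝ} (hG : EdgeCont G l)
    {K : Set ℝ} (hK : IsCompact K) {t₀ r₀ : ℝ} (ht₀ : t₀ ∈ Icc 0 l)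
    (h : ∀ p ∈ K, 0 < G t₀ r₀ p) :
    ∃ δ > 0, ∀ t ∈ Icc 0 l, |t - t₀| < δ → ∀ r, |r - r₀| < δ → ∀ p ∈ K, 0 < G t r p := by
  have key : ∀ᶠ x : ℝ × ℝ in 𝓝 (t₀, r₀), ∀ p ∈ K, x.1 ∈ Icc 0 l → 0 < G x.1 x.2 p := by
    refine hK.eventually_forall_of_forall_eventually
      (P := fun (x : ℝ × ℝ) p => x.1 ∈ Icc 0 l → 0 < G x.1 x.2 p) fun p hp => ?_
    have hc := hG (t₀, r₀, p) ⟨ht₀, trivial, trivial⟩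
    have h1 := hc.eventually (lt_mem_nhds (h p hp))
    rw [eventually_nhdsWithin_iff] at h1
    have hmap : Tendsto (fun z : (ℝ × ℝ) × ℝ => (z.1.1, z.1.2, z.2)) (𝓝 ((t₀, r₀), p))
        (𝓝 (t₀, r₀, p)) :=
      Continuous.tendsto (f := fun z : (ℝ × ℝ) × ℝ => (z.1.1, z.1.2, z.2)) (by fun_prop) _
    filter_upwards [hmap.eventually h1] with z hz hz1
    exact hz ⟨hz1, trivial, trivial⟩
  obtain ⟨δ, hδ, hb⟩ := Metric.eventually_nhds_iff.1 key
  refine ⟨δ, hδ, fun t ht htd r hr p hp => ?_⟩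
  refine hb (y := (t, r)) ?_ p hp ht
  rw [Prod.dist_eq, Real.dist_eq, Real.dist_eq]
  exact max_lt htd hr

lemma EdgeCont.neg_near_compact {G : ℝ → ℝ → ℝ → ℝ} {l : ℝ} (hG : EdgeCont G l)
    {K : Set ℝ} (hK : IsCompact K) {t₀ r₀ : ℝ} (ht₀ : t₀ ∈ Icc 0 l)
    (h : ∀ p ∈ K, G t₀ r₀ p < 0) :
    ∃ δ > 0, ∀ t ∈ Icc 0 l, |t - t₀| < δ → ∀ r, |r - r₀| < δ → ∀ p ∈ K, G t r p < 0 := by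
  have hG' : EdgeCont (fun t r p => -G t r p) l := ContinuousOn.neg hG
  obtain ⟨δ, hδ, hb⟩ := hG'.pos_near_compact hK ht₀ (r₀ := r₀)
    (fun p hp => neg_pos.2 (h p hp))
  exact ⟨δ, hδ, fun t ht htd r hr p hp => neg_pos.1 (hb t ht htd r hr p hp)⟩

/-- Positivity of `G(0,r₀,p)` for `|p| ≥ c` persists near `(0,r₀)`, uniformly in `p`. -/
lemma EdgeCont.pos_near_of_coercive {G : ℝ → ℝ → ℝ → ℝ} {l : ℝ} (hl : 0 ≤ l)
    (hG : EdgeCont G l) (hco : EdgeCoercive G l) {r₀ c : ℝ}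
    (h : ∀ p, c ≤ |p| → 0 < G 0 r₀ p) :
    ∃ δ > 0, ∀ t ∈ Icc 0 l, t < δ → ∀ r, |r - r₀| < δ → ∀ p, c ≤ |p| → 0 < G t r p := by
  obtain ⟨M, hM⟩ := hco (|r₀| + 1) (by positivity) 0
  have hK : IsCompact {p : ℝ | c ≤ |p| ∧ |p| ≤ M} := by
    refine (isCompact_Icc (a := -M) (b := M)).of_isClosed_subset ?_ ?_
    · exact (isClosed_le continuous_const continuous_abs).inter
        (isClosed_le continuous_abs continuous_const)
    · rintro p ⟨-, hp⟩
      exact abs_le.1 hp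
  obtain ⟨δ, hδ, hb⟩ := hG.pos_near_compact hK (left_mem_Icc.2 hl) (fun p hp => h p hp.1)
  refine ⟨min δ 1, lt_min hδ one_pos, fun t ht htd r hr p hp => ?_⟩
  by_cases hpM : |p| ≤ M
  · refine hb t ht ?_ r (hr.trans_le (min_le_left _ _)) p ⟨hp, hpM⟩
    rw [sub_zero, abs_of_nonneg ht.1]
    exact htd.trans_le (min_le_left _ _)
  · refine hM t ht r ?_ p (not_le.1 hpM)
    have h1 : |r - r₀| < 1 := hr.trans_le (min_le_right _ _)
    have h2 : |r| ≤ |r₀| + |r - r₀| := by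
      simpa using abs_add_le r₀ (r - r₀)
    linarith

lemma UpperSemicontinuousOn.lt_near_left {U : ℝ → ℝ} {l : ℝ} (hl : 0 ≤ l)
    (hU : UpperSemicontinuousOn U (Icc 0 l)) {δ : ℝ} (hδ : 0 < δ) :
    ∃ η > 0, ∀ t ∈ Icc 0 l, t < η → U t < U 0 + δ := by
  have h := hU 0 (left_mem_Icc.2 hl) (U 0 + δ) (by linarith)
  rw [eventually_nhdsWithin_iff, Metric.eventually_nhds_iff] at h
  obtain ⟨η, hη, hb⟩ := h
  refine ⟨η, hη, fun t ht htη => hb ?_ ht⟩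
  rwa [Real.dist_eq, sub_zero, abs_of_nonneg ht.1]

/-- One-sided slope bound from above at the left end point. -/
lemma IsEdgeSubsol.le_linear_near_left {G : ℝ → ℝ → ℝ → ℝ} {l B c c' : ℝ} {U : ℝ → ℝ}
    (hl : 0 < l) (hG : EdgeCont G l) (hco : EdgeCoercive G l) (hsub : IsEdgeSubsol G l U)
    (hU : UpperSemicontinuousOn U (Icc 0 l)) (hB : ∀ t ∈ Icc 0 l, |U t| ≤ B)
    (h : ∀ p, c ≤ |p| → 0 < G 0 (U 0) p) (hc : c < c') :
    ∃ η > 0, ∀ t ∈ Icc 0 l, t < η → U t ≤ U 0 + c' * t := by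
  obtain ⟨δ, hδ, hpos⟩ := hG.pos_near_of_coercive hl.le hco h
  obtain ⟨δ₁, hδ₁, husc⟩ := UpperSemicontinuousOn.lt_near_left hl.le hU hδ
  obtain ⟨d, hd0, hd1, hd2, hdl, hdc⟩ : ∃ d > 0, d < δ ∧ d < δ₁ ∧ d < l ∧ |c| * d < δ := by
    have h1 : 0 < δ / (|c| + 1) := by positivity
    refine ⟨min (min δ δ₁) (min l (δ / (|c| + 1))) / 2, by positivity, ?_⟩
    set m := min (min δ δ₁) (min l (δ / (|c| + 1))) with hm
    have hm0 : 0 < m := by positivity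
    have e1 : m ≤ δ := (min_le_left _ _).trans (min_le_left _ _)
    have e2 : m ≤ δ₁ := (min_le_left _ _).trans (min_le_right _ _)
    have e3 : m ≤ l := (min_le_right _ _).trans (min_le_left _ _)
    have e4 : m ≤ δ / (|c| + 1) := (min_le_right _ _).trans (min_le_right _ _)
    rw [le_div_iff₀ (by positivity)] at e4
    refine ⟨by linarith, by linarith, by linarith, ?_⟩
    nlinarith [abs_nonneg c]
  have h0l : (0 : ℝ) ∈ Icc 0 l := left_mem_Icc.2 hl.le
  have hB0 : 0 ≤ B := (abs_nonneg _).trans (hB 0 h0l)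
  set C := (2 * B + |c| * d + 1) / d ^ 2 with hC
  have hC0 : 0 < C := by positivity
  have hCd : C * d ^ 2 = 2 * B + |c| * d + 1 := by
    rw [hC]; field_simp
  refine ⟨min d ((c' - c) / C), lt_min hd0 (div_pos (by linarith) hC0), fun t ht htη => ?_⟩
  by_contra! hlt
  have htd : t < d := htη.trans_le (min_le_left _ _)
  have htC : C * t < c' - c := by
    have := htη.trans_le (min_le_right _ _)
    rwa [lt_div_iff₀ hC0, mul_comm] at this
  have hsubset : Icc 0 d ⊆ Icc 0 l := Icc_subset_Icc_right hdl.le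
  have hf : UpperSemicontinuousOn (fun x => U x + -(c * x + C * x ^ 2)) (Icc 0 d) := by
    refine (hU.mono hsubset).add (ContinuousOn.upperSemicontinuousOn ?_)
    fun_prop
  obtain ⟨x, hx, hmax⟩ := hf.exists_isMaxOn ⟨0, left_mem_Icc.2 hd0.le⟩ isCompact_Icc
  have hxt : U t + -(c * t + C * t ^ 2) ≤ U x + -(c * x + C * x ^ 2) := hmax ⟨ht.1, htd.le⟩
  have hfx : U 0 ≤ U t + -(c * t + C * t ^ 2) := by
    nlinarith [ht.1]
  have hfx' : U 0 < U t + -(c * t + C * t ^ 2) := by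
    nlinarith [ht.1]
  have hx0 : x ≠ 0 := by
    rintro rfl
    norm_num at hxt
    linarith
  have hxd : x ≠ d := by
    rintro rfl
    have h1 := abs_le.1 (hB x (hsubset hx))
    have h2 := abs_le.1 (hB 0 h0l)
    have h3 : -(c * x) ≤ |c| * x := by nlinarith [neg_abs_le c]
    linarith
  have hxI : x ∈ Ioo 0 d := ⟨lt_of_le_of_ne hx.1 hx0.symm, lt_of_le_of_ne hx.2 hxd⟩
  have hloc : IsLocalMax (fun y => U y - (c * y + C * y ^ 2)) x := by
    simpa only [sub_eq_add_neg] using hmax.isLocalMax (Icc_mem_nhds hxI.1 hxI.2)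
  have hder : HasDerivAt (fun y : ℝ => c * y + C * y ^ 2) (c + 2 * C * x) x := by
    have := ((hasDerivAt_id' x).const_mul c).add (((hasDerivAt_id' x).pow 2).const_mul C)
    refine this.congr_deriv ?_
    norm_num
    ring
  have hle := hsub x ⟨hxI.1, hxI.2.trans hdl⟩ _ _ (by fun_prop) hder hloc
  have hCx : 0 ≤ 2 * C * x := by have := hx.1; positivity
  refine absurd hle (not_le.2 (hpos x (hsubset hx) (hxI.2.trans hd1) _ ?_ _ ?_))
  · have h1 := husc x (hsubset hx) (hxI.2.trans hd2)
    have h2 : -(|c| * d) ≤ c * x := by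
      nlinarith [neg_abs_le c, abs_nonneg c, hx.1, hx.2]
    have h3 : 0 ≤ C * x ^ 2 := by positivity
    rw [abs_lt]
    constructor <;> linarith
  · exact le_trans (by linarith) (le_abs_self _)

/-- A subsolution either stays above or stays below the line of slope `-c` issuing from its value
at the left end point. -/
lemma IsEdgeSubsol.linear_le_or_le_linear_near_left {G : ℝ → ℝ → ℝ → ℝ} {l c : ℝ} {U : ℝ → ℝ}
    (hl : 0 < l) (hG : EdgeCont G l) (hco : EdgeCoercive G l) (hsub : IsEdgeSubsol G l U)
    (hU : UpperSemicontinuousOn U (Icc 0 l)) (h : ∀ p, c ≤ |p| → 0 < G 0 (U 0) p) :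
    (∃ η > 0, ∀ t ∈ Icc 0 l, t < η → U 0 - c * t ≤ U t) ∨
      ∃ η > 0, ∀ t ∈ Icc 0 l, t < η → U t ≤ U 0 - c * t := by
  obtain ⟨δ, hδ, hpos⟩ := hG.pos_near_of_coercive hl.le hco h
  obtain ⟨δ₁, hδ₁, husc⟩ := UpperSemicontinuousOn.lt_near_left hl.le hU hδ
  have h1 : 0 < δ / (|c| + 1) := by positivity
  by_contra! hcon
  obtain ⟨t, ht, htη, hlt⟩ := hcon.1 (min (min δ δ₁) (min l (δ / (|c| + 1)))) (by positivity)
  simp only [lt_min_iff] at htη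
  obtain ⟨⟨ht1, ht2⟩, ht3, ht4⟩ := htη
  rw [lt_div_iff₀ (by positivity)] at ht4
  have ht0 : 0 < t := by
    refine lt_of_le_of_ne ht.1 ?_
    rintro rfl
    norm_num at hlt
  obtain ⟨y, hy, hyt, hylt⟩ := hcon.2 t ht0
  have hsubset : Icc 0 t ⊆ Icc 0 l := Icc_subset_Icc_right ht3.le
  have hf : UpperSemicontinuousOn (fun x => U x + c * x) (Icc 0 t) := by
    refine (hU.mono hsubset).add (ContinuousOn.upperSemicontinuousOn ?_)
    fun_prop
  obtain ⟨x, hx, hmax⟩ := hf.exists_isMaxOn ⟨0, left_mem_Icc.2 ht0.le⟩ isCompact_Icc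
  have hxy : U y + c * y ≤ U x + c * x := hmax ⟨hy.1, hyt.le⟩
  have hx0 : x ≠ 0 := by
    rintro rfl
    norm_num at hxy
    linarith
  have hxt : x ≠ t := by
    rintro rfl
    linarith
  have hxI : x ∈ Ioo 0 t := ⟨lt_of_le_of_ne hx.1 hx0.symm, lt_of_le_of_ne hx.2 hxt⟩
  have hloc : IsLocalMax (fun y => U y - -c * y) x := by
    simpa only [neg_mul, sub_neg_eq_add] using hmax.isLocalMax (Icc_mem_nhds hxI.1 hxI.2)
  have hder : HasDerivAt (fun y : ℝ => -c * y) (-c) x := by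
    simpa using (hasDerivAt_id' x).const_mul (-c)
  have hle := hsub x ⟨hxI.1, hxI.2.trans ht3⟩ _ _ (by fun_prop) hder hloc
  refine absurd hle (not_le.2 (hpos x (hsubset hx) (hxI.2.trans ht1) _ ?_ _ ?_))
  · have h1 := husc x (hsubset hx) (hxI.2.trans ht2)
    have h2 : c * x ≤ |c| * t := by
      nlinarith [le_abs_self c, abs_nonneg c, hx.1, hx.2]
    rw [abs_lt]
    constructor <;> linarith
  · rw [abs_neg]
    exact le_abs_self _

/-- A supersolution with a linear lower bound of small slope at the left end point has a one-sided
local minimum there. -/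
lemma IsEdgeSupersol.le_near_left {G : ℝ → ℝ → ℝ → ℝ} {l a L : ℝ} {V : ℝ → ℝ}
    (hl : 0 < l) (hG : EdgeCont G l) (hsup : IsEdgeSupersol G l V)
    (hV : LowerSemicontinuousOn V (Icc 0 l)) (h : ∀ p, |p| ≤ L → G 0 (V 0) p < 0)
    (ha : 0 ≤ a) (haL : a < L)
    (hlow : ∃ η > 0, ∀ t ∈ Icc 0 l, t < η → V 0 - a * t ≤ V t) :
    ∃ η > 0, ∀ t ∈ Icc 0 l, t < η → V 0 ≤ V t := by
  obtain ⟨δ₁, hδ₁, hlow⟩ := hlow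
  obtain ⟨δ, hδ, hneg⟩ := hG.neg_near_compact (isCompact_Icc (a := -L) (b := L))
    (left_mem_Icc.2 hl.le) (fun p hp => h p (abs_le.2 hp))
  have hL : 0 < L := ha.trans_lt haL
  obtain ⟨d, hd0, hd1, hd2, hdl, hdc⟩ : ∃ d > 0, d < δ ∧ d < δ₁ ∧ d < l ∧ L * d < δ := by
    have h1 : 0 < δ / L := by positivity
    refine ⟨min (min δ δ₁) (min l (δ / L)) / 2, by positivity, ?_⟩
    set m := min (min δ δ₁) (min l (δ / L)) with hm
    have hm0 : 0 < m := by positivity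
    have e1 : m ≤ δ := (min_le_left _ _).trans (min_le_left _ _)
    have e2 : m ≤ δ₁ := (min_le_left _ _).trans (min_le_right _ _)
    have e3 : m ≤ l := (min_le_right _ _).trans (min_le_left _ _)
    have e4 : m ≤ δ / L := (min_le_right _ _).trans (min_le_right _ _)
    rw [le_div_iff₀ (by positivity)] at e4
    exact ⟨by linarith, by linarith, by linarith, by nlinarith⟩
  set κ := (L - a) * d / (2 * L) with hκ
  have hκ0 : 0 < κ := by
    have : 0 < L - a := by linarith
    positivity
  have hκL : 2 * L * κ = (L - a) * d := by rw [hκ]; field_simp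
  have hκd : κ < d := by nlinarith
  refine ⟨κ, hκ0, fun t ht htκ => ?_⟩
  by_contra! hlt
  have ht0 : 0 < t := by
    refine lt_of_le_of_ne ht.1 ?_
    rintro rfl
    exact lt_irrefl _ hlt
  have hsubset : Icc 0 d ⊆ Icc 0 l := Icc_subset_Icc_right hdl.le
  set φ : ℝ → ℝ := fun y => -L * y + 2 * L * κ * (y / (κ + y)) with hφ
  have hφc : ContinuousOn φ (Icc 0 l) := by
    have : ∀ y ∈ Icc 0 l, κ + y ≠ 0 := fun y hy => by linarith [hy.1]
    fun_prop (disch := assumption)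
  have hf : LowerSemicontinuousOn (fun x => V x + -φ x) (Icc 0 d) :=
    (hV.mono hsubset).add (hφc.mono hsubset).neg.lowerSemicontinuousOn
  obtain ⟨x, hx, hmin⟩ := hf.exists_isMinOn ⟨0, left_mem_Icc.2 hd0.le⟩ isCompact_Icc
  have hxt : V x + -φ x ≤ V t + -φ t := hmin ⟨ht.1, (htκ.trans hκd).le⟩
  have hφt : 0 ≤ φ t := by
    have h1 : t / (2 * κ) ≤ t / (κ + t) :=
      div_le_div_of_nonneg_left ht0.le (by linarith) (by linarith)
    have h2 : 2 * L * κ * (t / (2 * κ)) = L * t := by field_simp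
    have h3 : 2 * L * κ * (t / (2 * κ)) ≤ 2 * L * κ * (t / (κ + t)) := by gcongr
    simp only [hφ]
    linarith
  have hφx : φ x ≤ L * x := by
    have h1 : x / (κ + x) ≤ x / κ :=
      div_le_div_of_nonneg_left hx.1 (by linarith) (by linarith [hx.1])
    have h2 : 2 * L * κ * (x / κ) = 2 * L * x := by field_simp
    have h3 : 2 * L * κ * (x / (κ + x)) ≤ 2 * L * κ * (x / κ) := by gcongr
    simp only [hφ]
    linarith
  have hx0 : x ≠ 0 := by
    rintro rfl
    simp [hφ] at hxt
    simp only [hφ] at hφt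
    linarith
  have hVx := hlow x (hsubset hx) (hx.2.trans_lt hd2)
  have hxd : x ≠ d := by
    rintro rfl
    have h1 : x / (κ + x) < 1 := by rw [div_lt_one (by linarith)]; linarith
    have h2 : 2 * L * κ * (x / (κ + x)) < (L - a) * x := by
      rw [hκL]
      have : 0 < (L - a) * x := mul_pos (by linarith) hd0
      nlinarith
    have h3 : φ x < -a * x := by simp only [hφ]; linarith
    linarith
  have hxI : x ∈ Ioo 0 d := ⟨lt_of_le_of_ne hx.1 hx0.symm, lt_of_le_of_ne hx.2 hxd⟩
  have hloc : IsLocalMin (fun y => V y - φ y) x := by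
    simpa only [sub_eq_add_neg] using hmin.isLocalMin (Icc_mem_nhds hxI.1 hxI.2)
  have hκx : κ + x ≠ 0 := by linarith [hx.1]
  have hder : HasDerivAt φ (-L + 2 * L * (κ ^ 2 / (κ + x) ^ 2)) x := by
    have h1 := (hasDerivAt_id' x).div ((hasDerivAt_id' x).const_add κ) hκx
    have h2 := ((hasDerivAt_id' x).const_mul (-L)).add (h1.const_mul (2 * L * κ))
    refine h2.congr_deriv ?_
    field_simp
    ring
  have hge := hsup x ⟨hxI.1, hxI.2.trans hdl⟩ _ _ hφc hder hloc
  refine absurd hge (not_le.2 (hneg x (hsubset hx) ?_ _ ?_ _ ?_))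
  · rw [sub_zero, abs_of_nonneg hx.1]
    exact hxI.2.trans hd1
  · have h1 : L * x < δ := by nlinarith [hx.2]
    have h2 : a * x ≤ L * x := by nlinarith [hx.1]
    rw [abs_lt]
    constructor <;> linarith
  · have h1 : κ ^ 2 / (κ + x) ^ 2 ≤ 1 := by
      rw [div_le_one (by positivity)]
      nlinarith [hx.1]
    have h2 : 0 ≤ κ ^ 2 / (κ + x) ^ 2 := by positivity
    constructor <;> nlinarith

/-- Doubling of variables: the difference of a subsolution and a supersolution cannot have a
positive maximum in the interior of an edge. -/
lemma IsEdgeSubsol.not_interior_max {G : ℝ → ℝ → ℝ → ℝ} {l B z : ℝ} {U V : ℝ → ℝ}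
    (hG : EdgeCont G l) (hco : EdgeCoercive G l) (hsub : IsEdgeSubsol G l U)
    (hsup : IsEdgeSupersol G l V)
    (hU : UpperSemicontinuousOn U (Icc 0 l)) (hV : LowerSemicontinuousOn V (Icc 0 l))
    (hBU : ∀ t ∈ Icc 0 l, |U t| ≤ B) (hBV : ∀ t ∈ Icc 0 l, |V t| ≤ B)
    (hz : z ∈ Ioo 0 l) (hmax : ∀ t ∈ Icc 0 l, U t - V t ≤ U z - V z)
    (hstrict : ∀ p, G z (V z) p < G z (U z) p) : False := by
  have hzI : z ∈ Icc 0 l := Ioo_subset_Icc_self hz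
  have hUq : UpperSemicontinuousOn (fun q : ℝ × ℝ => U q.1) (Icc 0 l ×ˢ Icc 0 l) :=
    hU.comp continuousOn_fst fun q hq => hq.1
  have hVq : UpperSemicontinuousOn (fun q : ℝ × ℝ => -V q.2) (Icc 0 l ×ˢ Icc 0 l) := by
    have := continuous_neg.comp_lowerSemicontinuousOn_antitone hV (fun a b h => neg_le_neg h)
    exact this.comp continuousOn_snd fun q hq => hq.2
  have hexists : ∀ n : ℕ, ∃ q ∈ Icc 0 l ×ˢ Icc 0 l, ∀ q' ∈ Icc 0 l ×ˢ Icc 0 l,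
      U q'.1 + -V q'.2 + -(n * (q'.1 - q'.2) ^ 2 + (q'.1 - z) ^ 2) ≤
        U q.1 + -V q.2 + -(n * (q.1 - q.2) ^ 2 + (q.1 - z) ^ 2) := by
    intro n
    have hf : UpperSemicontinuousOn
        (fun q : ℝ × ℝ => U q.1 + -V q.2 + -(n * (q.1 - q.2) ^ 2 + (q.1 - z) ^ 2))
        (Icc 0 l ×ˢ Icc 0 l) := by
      refine (hUq.add hVq).add (ContinuousOn.upperSemicontinuousOn ?_)
      fun_prop
    obtain ⟨q, hq, hqm⟩ :=
      hf.exists_isMaxOn (Set.Nonempty.prod ⟨z, hzI⟩ ⟨z, hzI⟩) (isCompact_Icc.prod isCompact_Icc)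
    exact ⟨q, hq, fun q' hq' => hqm hq'⟩
  choose q hq hqm using hexists
  obtain ⟨w, hw, f, hfm, hqw⟩ := (isCompact_Icc.prod isCompact_Icc).tendsto_subseq hq
  have hdiag : ∀ n, U z - V z + n * ((q n).1 - (q n).2) ^ 2 + ((q n).1 - z) ^ 2 ≤
      U (q n).1 - V (q n).2 := by
    intro n
    have := hqm n (z, z) ⟨hzI, hzI⟩
    norm_num at this
    linarith
  have hx : Tendsto (fun n => (q (f n)).1) atTop (𝓝 w.1) := (continuous_fst.tendsto _).comp hqw
  have hy : Tendsto (fun n => (q (f n)).2) atTop (𝓝 w.2) := (continuous_snd.tendsto _).comp hqw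
  have hfn : Tendsto (fun n => (f n : ℝ)) atTop atTop :=
    tendsto_natCast_atTop_atTop.comp hfm.tendsto_atTop
  have hw12 : w.1 = w.2 := by
    have h1 : Tendsto (fun n => ((q (f n)).1 - (q (f n)).2) ^ 2) atTop (𝓝 0) := by
      have h2 : Tendsto (fun n => 4 * B / (f n : ℝ)) atTop (𝓝 0) := hfn.const_div_atTop _
      refine tendsto_of_tendsto_of_tendsto_of_le_of_le' tendsto_const_nhds h2
        (Eventually.of_forall fun n => sq_nonneg _) ?_
      filter_upwards [hfn.eventually_gt_atTop 0] with n hn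
      rw [le_div_iff₀ hn]
      have e1 := abs_le.1 (hBU _ (hq (f n)).1)
      have e2 := abs_le.1 (hBV _ (hq (f n)).2)
      have e3 := abs_le.1 (hBU _ hzI)
      have e4 := abs_le.1 (hBV _ hzI)
      have e5 := hdiag (f n)
      nlinarith [sq_nonneg ((q (f n)).1 - z)]
    have h2 := tendsto_nhds_unique h1 ((hx.sub hy).pow 2)
    have h3 : (w.1 - w.2) = 0 := by
      simpa using h2.symm
    linarith
  have hUev : ∀ t ∈ Icc 0 l, Tendsto (fun n => (q (f n)).1) atTop (𝓝 t) → ∀ ε > 0,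
      ∀ᶠ n in atTop, U (q (f n)).1 < U t + ε := by
    intro t ht hlim ε hε
    have h1 := hU t ht (U t + ε) (by linarith)
    exact (tendsto_nhdsWithin_iff.2 ⟨hlim, Eventually.of_forall fun n => (hq (f n)).1⟩).eventually h1
  have hVev : ∀ t ∈ Icc 0 l, Tendsto (fun n => (q (f n)).2) atTop (𝓝 t) → ∀ ε > 0,
      ∀ᶠ n in atTop, V t - ε < V (q (f n)).2 := by
    intro t ht hlim ε hε
    have h1 := hV t ht (V t - ε) (by linarith)
    exact (tendsto_nhdsWithin_iff.2 ⟨hlim, Eventually.of_forall fun n => (hq (f n)).2⟩).eventually h1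
  have hwz : w.1 = z := by
    have h1 : (w.1 - z) ^ 2 ≤ 0 := by
      refine le_of_forall_pos_le_add fun ε hε => ?_
      refine le_of_tendsto ((hx.sub_const z).pow 2) ?_
      filter_upwards [hUev w.1 hw.1 hx (ε / 2) (by positivity),
        hVev w.1 hw.1 (hw12 ▸ hy) (ε / 2) (by positivity)] with n h1 h2
      have h3 := hdiag (f n)
      have h4 := hmax w.1 hw.1
      have h5 : 0 ≤ (f n : ℝ) * ((q (f n)).1 - (q (f n)).2) ^ 2 := by positivity
      linarith
    have h2 : w.1 - z = 0 := by
      have := le_antisymm h1 (sq_nonneg _)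
      simpa using this
    linarith
  have hx : Tendsto (fun n => (q (f n)).1) atTop (𝓝 z) := hwz ▸ hx
  have hy : Tendsto (fun n => (q (f n)).2) atTop (𝓝 z) := by rwa [← hw12, hwz] at hy
  have hle : ∀ n, U z - V z ≤ U (q n).1 - V (q n).2 := by
    intro n
    have h3 := hdiag n
    have h5 : 0 ≤ (n : ℝ) * ((q n).1 - (q n).2) ^ 2 := by positivity
    nlinarith [sq_nonneg ((q n).1 - z)]
  have hUlim : Tendsto (fun n => U (q (f n)).1) atTop (𝓝 (U z)) := by
    rw [Metric.tendsto_nhds]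
    intro ε hε
    filter_upwards [hUev z hzI hx ε hε, hVev z hzI hy ε hε] with n h1 h2
    rw [Real.dist_eq, abs_lt]
    constructor <;> linarith [hle (f n)]
  have hVlim : Tendsto (fun n => V (q (f n)).2) atTop (𝓝 (V z)) := by
    rw [Metric.tendsto_nhds]
    intro ε hε
    filter_upwards [hUev z hzI hx ε hε, hVev z hzI hy ε hε] with n h1 h2
    rw [Real.dist_eq, abs_lt]
    constructor <;> linarith [hle (f n)]
  set p : ℕ → ℝ := fun n => 2 * f n * ((q (f n)).1 - (q (f n)).2) with hp
  have hGsub : ∀ᶠ n in atTop,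
      G (q (f n)).1 (U (q (f n)).1) (p n + 2 * ((q (f n)).1 - z)) ≤ 0 := by
    filter_upwards [hx.eventually (Ioo_mem_nhds hz.1 hz.2)] with n hn
    have hder : HasDerivAt (fun t : ℝ => f n * (t - (q (f n)).2) ^ 2 + (t - z) ^ 2)
        (p n + 2 * ((q (f n)).1 - z)) (q (f n)).1 := by
      have := ((((hasDerivAt_id' (q (f n)).1).sub_const (q (f n)).2).pow 2).const_mul
        (f n : ℝ)).add (((hasDerivAt_id' (q (f n)).1).sub_const z).pow 2)
      refine this.congr_deriv ?_
      norm_num [hp]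
      ring
    refine hsub _ hn _ _ (by fun_prop) hder ?_
    filter_upwards [Icc_mem_nhds hn.1 hn.2] with t ht
    have := hqm (f n) (t, (q (f n)).2) ⟨ht, (hq (f n)).2⟩
    dsimp only at this
    linarith
  have hGsup : ∀ᶠ n in atTop, 0 ≤ G (q (f n)).2 (V (q (f n)).2) (p n) := by
    filter_upwards [hy.eventually (Ioo_mem_nhds hz.1 hz.2)] with n hn
    have hder : HasDerivAt (fun t : ℝ => -(f n * ((q (f n)).1 - t) ^ 2)) (p n) (q (f n)).2 := by
      have := ((((hasDerivAt_id' (q (f n)).2).const_sub (q (f n)).1).pow 2).const_mul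
        (f n : ℝ)).neg
      refine this.congr_deriv ?_
      norm_num [hp]
      ring
    refine hsup _ hn _ _ (by fun_prop) hder ?_
    filter_upwards [Icc_mem_nhds hn.1 hn.2] with t ht
    have := hqm (f n) ((q (f n)).1, t) ⟨(hq (f n)).1, ht⟩
    dsimp only at this
    linarith
  have hB0 : 0 ≤ B := (abs_nonneg _).trans (hBU z hzI)
  obtain ⟨M, hM⟩ := hco (B + 1) (by linarith) 0
  have hbdd : ∃ᶠ n in atTop, p n + 2 * ((q (f n)).1 - z) ∈ Icc (-M) M := by
    refine Eventually.frequently ?_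
    filter_upwards [hGsub] with n hn
    refine abs_le.1 (not_lt.1 fun hlt => ?_)
    exact absurd hn (not_le.2 (hM _ (hq (f n)).1 _ ((hBU _ (hq (f n)).1).trans (by linarith)) _ hlt))
  obtain ⟨P, -, g, hgm, hgP⟩ := isCompact_Icc.tendsto_subseq' hbdd
  have hx' := hx.comp hgm.tendsto_atTop
  have hpP : Tendsto (p ∘ g) atTop (𝓝 P) := by
    have h1 := hgP.sub ((hx'.sub_const z).const_mul 2)
    simp only [sub_self, mul_zero, sub_zero] at h1
    refine h1.congr fun n => ?_
    simp
  have hlim : ∀ (x r s : ℕ → ℝ) (r₀ : ℝ), (∀ n, x n ∈ Icc 0 l) → Tendsto x atTop (𝓝 z) →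
      Tendsto r atTop (𝓝 r₀) → Tendsto s atTop (𝓝 P) →
      Tendsto (fun n => G (x n) (r n) (s n)) atTop (𝓝 (G z r₀ P)) := by
    intro x r s r₀ hxI hx hr hs
    have hc := hG (z, r₀, P) ⟨hzI, trivial, trivial⟩
    exact hc.tendsto.comp (tendsto_nhdsWithin_iff.2
      ⟨hx.prodMk_nhds (hr.prodMk_nhds hs), Eventually.of_forall fun n => ⟨hxI n, trivial, trivial⟩⟩)
  have h1 : G z (U z) P ≤ 0 :=
    le_of_tendsto (hlim _ _ _ _ (fun n => (hq (f (g n))).1) hx'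
      (hUlim.comp hgm.tendsto_atTop) hgP) (hgm.tendsto_atTop.eventually hGsub)
  have h2 : 0 ≤ G z (V z) P :=
    ge_of_tendsto (hlim _ _ _ _ (fun n => (hq (f (g n))).2) (hy.comp hgm.tendsto_atTop)
      (hVlim.comp hgm.tendsto_atTop) hpP) (hgm.tendsto_atTop.eventually hGsup)
  linarith [hstrict P]

end EdgeProblem

namespace Network

open Filter Topology

variable {N : Network} {H : N.J → ℝ → ℝ → ℝ → ℝ} {u : N.J → ℝ → ℝ} {i : N.I} {j k : N.J}

variable (N) in
/-- The point of the edge `j` at distance `t` from its end point `i`. -/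
def out (i : N.I) (j : N.J) (t : ℝ) : ℝ := N.param i j + N.sgn i j * t

/-- The Hamiltonian on the edge `j` in the coordinate `t` measured from the end point `i`. -/
def edgeH (H : N.J → ℝ → ℝ → ℝ → ℝ) (i : N.I) (j : N.J) (t r p : ℝ) : ℝ :=
  H j (N.out i j t) r (N.sgn i j * p)

lemma sgn_param_cases (hj : j ∈ N.Inc i) :
    (N.sgn i j = 1 ∧ N.param i j = 0) ∨ (N.sgn i j = -1 ∧ N.param i j = N.l j) := by
  unfold sgn param
  rcases hj with rfl | rfl
  · simp
  · simp [N.st_ne j]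

lemma sgn_mul_self (i : N.I) (j : N.J) : N.sgn i j * N.sgn i j = 1 := by
  unfold sgn
  split_ifs <;> norm_num

lemma abs_sgn (i : N.I) (j : N.J) : |N.sgn i j| = 1 := by
  unfold sgn
  split_ifs <;> norm_num

@[simp] lemma out_zero (i : N.I) (j : N.J) : N.out i j 0 = N.param i j := by
  simp [out]

lemma out_sgn_mul_sub (i : N.I) (j : N.J) (x : ℝ) :
    N.out i j (N.sgn i j * (x - N.param i j)) = x := by
  unfold out
  linear_combination (x - N.param i j) * sgn_mul_self i j

lemma sgn_mul_out_sub (i : N.I) (j : N.J) (t : ℝ) :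
    N.sgn i j * (N.out i j t - N.param i j) = t := by
  unfold out
  linear_combination t * sgn_mul_self i j

lemma out_mem_edge (hj : j ∈ N.Inc i) {t : ℝ} (ht : t ∈ Icc 0 (N.l j)) :
    N.out i j t ∈ N.edge j := by
  unfold out edge
  rcases sgn_param_cases hj with ⟨h1, h2⟩ | ⟨h1, h2⟩ <;> rw [h1, h2] <;>
    constructor <;> linarith [ht.1, ht.2]

lemma out_mem_Ioo (hj : j ∈ N.Inc i) {t : ℝ} (ht : t ∈ Ioo 0 (N.l j)) :
    N.out i j t ∈ Ioo 0 (N.l j) := by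
  unfold out
  rcases sgn_param_cases hj with ⟨h1, h2⟩ | ⟨h1, h2⟩ <;> rw [h1, h2] <;>
    constructor <;> linarith [ht.1, ht.2]

lemma param_mem_edge (hj : j ∈ N.Inc i) : N.param i j ∈ N.edge j := by
  simpa using out_mem_edge hj (left_mem_Icc.2 (N.l_pos j).le)

lemma abs_sub_param_mem (hj : j ∈ N.Inc i) {x : ℝ} (hx : x ∈ N.edge j) :
    |x - N.param i j| ∈ Icc 0 (N.l j) := by
  refine ⟨abs_nonneg _, abs_le.2 ?_⟩
  rcases sgn_param_cases hj with ⟨-, h2⟩ | ⟨-, h2⟩ <;> rw [h2] <;>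
    constructor <;> linarith [hx.1, hx.2, N.l_pos j]

lemma out_abs_sub_param (hj : j ∈ N.Inc i) {x : ℝ} (hx : x ∈ N.edge j) :
    N.out i j |x - N.param i j| = x := by
  unfold out
  rcases sgn_param_cases hj with ⟨h1, h2⟩ | ⟨h1, h2⟩ <;> rw [h1, h2]
  · rw [abs_of_nonneg (by linarith [hx.1])]
    ring
  · rw [abs_of_nonpos (by linarith [hx.2])]
    ring

lemma continuous_out (i : N.I) (j : N.J) : Continuous (N.out i j) := by
  unfold out
  fun_prop

lemma H0.edgeCont (hH0 : N.H0 H) (hj : j ∈ N.Inc i) : EdgeCont (edgeH H i j) (N.l j) := by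
  have hout := continuous_out i j
  refine (hH0 j).comp (g := fun q : ℝ × ℝ × ℝ => H j q.1 q.2.1 q.2.2)
    (f := fun q : ℝ × ℝ × ℝ => (N.out i j q.1, q.2.1, N.sgn i j * q.2.2))
    (Continuous.continuousOn (by fun_prop)) ?_
  rintro ⟨t, r, p⟩ ⟨ht, -, -⟩
  exact ⟨out_mem_edge hj ht, trivial, trivial⟩

lemma H4.edgeCoercive (hH4 : N.H4 H) (hj : j ∈ N.Inc i) :
    EdgeCoercive (edgeH H i j) (N.l j) := by
  intro R hR A
  obtain ⟨M, hM⟩ := hH4 j R hR A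
  refine ⟨M, fun t ht r hr p hp => hM _ (out_mem_edge hj ht) r hr _ ?_⟩
  rwa [abs_mul, abs_sgn, one_mul]

lemma isCont_of_vanish {φ : N.J → ℝ → ℝ} (hc : ∀ j, ContinuousOn (φ j) (N.edge j))
    (h0 : ∀ j, φ j 0 = 0) (hl : ∀ j, φ j (N.l j) = 0) : N.IsCont φ := by
  have h : ∀ i j, φ j (N.param i j) = 0 := by
    intro i j
    unfold param
    split_ifs
    exacts [h0 j, hl j]
  exact ⟨fun i j _ k _ => by rw [h, h], hc⟩

/-- A function given on one edge is, near an interior point of that edge, the restriction of a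
continuous function on the network. -/
lemma exists_isCont_eventuallyEq {y : ℝ} (hy : y ∈ Ioo 0 (N.l j)) {g : ℝ → ℝ}
    (hg : ContinuousOn g (N.edge j)) : ∃ φ, N.IsCont φ ∧ φ j =ᶠ[𝓝 y] g := by
  classical
  have hy' : 0 < N.l j - y := by linarith [hy.2]
  set χ : ℝ → ℝ := fun x => min 1 (min (2 * x / y) (2 * (N.l j - x) / (N.l j - y))) with hχ
  have hχc : Continuous χ := by fun_prop
  refine ⟨fun m x => if m = j then χ x * g x else 0,
    isCont_of_vanish (fun m => ?_) (fun m => ?_) (fun m => ?_), ?_⟩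
  · by_cases h : m = j
    · subst h
      simp only [if_true]
      exact hχc.continuousOn.mul hg
    · simpa [h] using continuousOn_const
  · split_ifs with h
    · have h0 : χ 0 = 0 := by
        have : 0 ≤ 2 * (N.l j - 0) / (N.l j - y) :=
          div_nonneg (by linarith [N.l_pos j]) hy'.le
        simp only [hχ, mul_zero, zero_div, min_eq_left this]
        norm_num
      simp [h0]
    · rfl
  · split_ifs with h
    · subst h
      have h0 : χ (N.l m) = 0 := by
        have : 0 ≤ 2 * N.l m / y := div_nonneg (by linarith [N.l_pos m]) hy.1.le
        simp only [hχ, sub_self, mul_zero, zero_div, min_eq_right this]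
        norm_num
      simp [h0]
    · rfl
  · have h1 : ∀ᶠ x in 𝓝 y, y / 2 < x := lt_mem_nhds (by linarith [hy.1])
    have h2 : ∀ᶠ x in 𝓝 y, x < y + (N.l j - y) / 2 := gt_mem_nhds (by linarith)
    filter_upwards [h1, h2] with x hx1 hx2
    have e1 : 1 ≤ 2 * x / y := by
      rw [le_div_iff₀ hy.1]
      linarith
    have e2 : 1 ≤ 2 * (N.l j - x) / (N.l j - y) := by
      rw [le_div_iff₀ hy']
      linarith
    have : χ x = 1 := min_eq_left (le_min e1 e2)
    simp [this]

/-- Pull back of a test function in the coordinate measured from an end point. -/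
lemma exists_test_of_out (hj : j ∈ N.Inc i) {t : ℝ} (ht : t ∈ Ioo 0 (N.l j)) {ψ : ℝ → ℝ} {p : ℝ}
    (hψ : ContinuousOn ψ (Icc 0 (N.l j))) (hder : HasDerivAt ψ p t) :
    ∃ φ, N.IsCont φ ∧ DifferentiableWithinAt ℝ (φ j) (N.edge j) (N.out i j t) ∧
      N.pd φ j (N.out i j t) = N.sgn i j * p ∧
      ∀ᶠ x in 𝓝 (N.out i j t), φ j x = ψ (N.sgn i j * (x - N.param i j)) := by
  have hss := sgn_mul_self i j
  have hg : ContinuousOn (fun x => ψ (N.sgn i j * (x - N.param i j))) (N.edge j) := by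
    refine hψ.comp (Continuous.continuousOn (by fun_prop)) fun x hx => ?_
    have h := abs_sub_param_mem hj hx
    have h' := out_abs_sub_param hj hx
    have : N.sgn i j * (x - N.param i j) = |x - N.param i j| := by
      unfold out at h'
      linear_combination -N.sgn i j * h' + |x - N.param i j| * hss
    rwa [this]
  obtain ⟨φ, hφ, hev⟩ := exists_isCont_eventuallyEq (out_mem_Ioo hj ht) hg
  have hd : HasDerivAt (φ j) (N.sgn i j * p) (N.out i j t) := by
    refine HasDerivAt.congr_of_eventuallyEq ?_ hev
    have h1 : HasDerivAt (fun x => N.sgn i j * (x - N.param i j)) (N.sgn i j) (N.out i j t) := by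
      simpa using ((hasDerivAt_id' (N.out i j t)).sub_const (N.param i j)).const_mul (N.sgn i j)
    rw [mul_comm]
    refine HasDerivAt.comp (h₂ := ψ) _ ?_ h1
    rwa [sgn_mul_out_sub]
  have hy := out_mem_Ioo hj ht
  refine ⟨φ, hφ, hd.differentiableAt.differentiableWithinAt, ?_, hev⟩
  exact (derivWithin_of_mem_nhds (Icc_mem_nhds hy.1 hy.2)).trans hd.deriv

lemma tendsto_sgn_mul_sub (i : N.I) (j : N.J) (t : ℝ) :
    Tendsto (fun x => N.sgn i j * (x - N.param i j)) (𝓝 (N.out i j t)) (𝓝 t) := by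
  have h : Continuous fun x => N.sgn i j * (x - N.param i j) := by fun_prop
  have h' := h.tendsto (N.out i j t)
  rwa [sgn_mul_out_sub] at h'

lemma IsSubsol.edgeSubsol (hu : N.IsSubsol H u) (hj : j ∈ N.Inc i) :
    IsEdgeSubsol (edgeH H i j) (N.l j) (fun t => u j (N.out i j t)) := by
  intro t ht ψ p hψ hder hloc
  obtain ⟨φ, hφ, hdiff, hpd, hev⟩ := exists_test_of_out hj ht hψ hder
  have key : ∀ᶠ x in 𝓝 (N.out i j t), u j x - φ j x ≤ u j (N.out i j t) - φ j (N.out i j t) := by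
    have hat := hev.self_of_nhds
    rw [sgn_mul_out_sub] at hat
    filter_upwards [hev, (tendsto_sgn_mul_sub i j t).eventually hloc] with x hx hx'
    rw [hx, hat]
    simpa only [out_sgn_mul_sub] using hx'
  obtain ⟨δ, hδ, hb⟩ := Metric.eventually_nhds_iff.1 key
  have := hu.2.1 j _ (out_mem_Ioo hj ht) φ hφ hdiff
    ⟨δ, hδ, fun x _ hx => hb (by rwa [Real.dist_eq])⟩
  rwa [hpd] at this

lemma IsSupersol.edgeSupersol (hu : N.IsSupersol H u) (hj : j ∈ N.Inc i) :
    IsEdgeSupersol (edgeH H i j) (N.l j) (fun t => u j (N.out i j t)) := by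
  intro t ht ψ p hψ hder hloc
  obtain ⟨φ, hφ, hdiff, hpd, hev⟩ := exists_test_of_out hj ht hψ hder
  have key : ∀ᶠ x in 𝓝 (N.out i j t), u j (N.out i j t) - φ j (N.out i j t) ≤ u j x - φ j x := by
    have hat := hev.self_of_nhds
    rw [sgn_mul_out_sub] at hat
    filter_upwards [hev, (tendsto_sgn_mul_sub i j t).eventually hloc] with x hx hx'
    rw [hx, hat]
    simpa only [out_sgn_mul_sub] using hx'
  obtain ⟨δ, hδ, hb⟩ := Metric.eventually_nhds_iff.1 key
  have := hu.2.1 j _ (out_mem_Ioo hj ht) φ hφ hdiff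
    ⟨δ, hδ, fun x _ hx => hb (by rwa [Real.dist_eq])⟩
  rwa [hpd] at this

lemma IsUSC.comp_out (hu : N.IsUSC u) (hj : j ∈ N.Inc i) :
    UpperSemicontinuousOn (fun t => u j (N.out i j t)) (Icc 0 (N.l j)) :=
  (hu.2 j).comp (continuous_out i j).continuousOn fun _ ht => out_mem_edge hj ht

lemma IsLSC.comp_out (hu : N.IsLSC u) (hj : j ∈ N.Inc i) :
    LowerSemicontinuousOn (fun t => u j (N.out i j t)) (Icc 0 (N.l j)) :=
  (hu.2 j).comp (continuous_out i j).continuousOn fun _ ht => out_mem_edge hj ht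

lemma min_eq_abs_sub_param (hj : j ∈ N.Inc i) {x : ℝ} (hx : x ∈ N.edge j)
    (h : |x - N.param i j| < N.l j / 2) : min x (N.l j - x) = |x - N.param i j| := by
  rcases sgn_param_cases hj with ⟨-, h2⟩ | ⟨-, h2⟩ <;> rw [h2] at h ⊢
  · rw [abs_of_nonneg (by linarith [hx.1])] at h ⊢
    rw [sub_zero] at h ⊢
    exact min_eq_left (by linarith)
  · rw [abs_of_nonpos (by linarith [hx.2])] at h ⊢
    rw [min_eq_right (by linarith)]
    ring

lemma hasDerivWithinAt_min (hj : j ∈ N.Inc i) :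
    HasDerivWithinAt (fun x => min x (N.l j - x)) (N.sgn i j) (N.edge j) (N.param i j) := by
  have hl := N.l_pos j
  have h1 : HasDerivWithinAt (fun x => N.sgn i j * (x - N.param i j)) (N.sgn i j) (N.edge j)
      (N.param i j) := by
    simpa using (((hasDerivAt_id' (N.param i j)).sub_const (N.param i j)).const_mul
      (N.sgn i j)).hasDerivWithinAt
  have hloc : ∀ x ∈ N.edge j, |x - N.param i j| < N.l j / 2 →
      min x (N.l j - x) = N.sgn i j * (x - N.param i j) := by
    intro x hx hxl
    rw [min_eq_abs_sub_param hj hx hxl]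
    have h' := out_abs_sub_param hj hx
    unfold out at h'
    linear_combination N.sgn i j * h' - |x - N.param i j| * sgn_mul_self i j
  refine h1.congr_of_eventuallyEq ?_ (hloc _ (param_mem_edge hj) (by simpa using hl))
  rw [EventuallyEq, eventually_nhdsWithin_iff, Metric.eventually_nhds_iff]
  exact ⟨N.l j / 2, by linarith, fun x hx hxe => hloc x hxe (by rwa [Real.dist_eq] at hx)⟩

/-- The subsolution condition at a transition vertex, with slopes `c` and `-c`. -/
lemma IsSubsol.vertex (hu : N.IsSubsol H u) (hi : i ∈ N.IT) (hj : j ∈ N.Inc i)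
    (hk : k ∈ N.Inc i) (hjk : j ≠ k) {c : ℝ}
    (hJ : ∃ η > 0, ∀ t ∈ Icc 0 (N.l j), t < η → u j (N.out i j t) ≤ u j (N.out i j 0) + c * t)
    (hK : ∃ η > 0, ∀ t ∈ Icc 0 (N.l k), t < η → u k (N.out i k t) ≤ u k (N.out i k 0) + -c * t) :
    edgeH H i j 0 (u j (N.out i j 0)) c ≤ 0 := by
  classical
  obtain ⟨η₁, hη₁, hJ⟩ := hJ
  obtain ⟨η₂, hη₂, hK⟩ := hK
  have hlj := N.l_pos j
  have hlk := N.l_pos k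
  set e : N.J → ℝ := fun m => if m = j then c else if m = k then -c else 0 with he
  have hej : e j = c := by simp [he]
  have hek : e k = -c := by simp [he, hjk.symm]
  set φ : N.J → ℝ → ℝ := fun m x => e m * min x (N.l m - x) with hφ
  have hφc : N.IsCont φ := by
    refine isCont_of_vanish (fun m => ?_) (fun m => ?_) (fun m => ?_)
    · simp only [hφ]
      fun_prop
    · simp [hφ, (N.l_pos m).le]
    · simp [hφ, (N.l_pos m).le]
  have hder : ∀ m ∈ N.Inc i, HasDerivWithinAt (φ m) (e m * N.sgn i m) (N.edge m) (N.param i m) :=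
    fun m hm => (hasDerivWithinAt_min hm).const_mul (e m)
  have hpd : ∀ m ∈ N.Inc i, N.pd φ m (N.param i m) = e m * N.sgn i m := fun m hm =>
    (hder m hm).derivWithin (uniqueDiffOn_Icc (N.l_pos m) _ (param_mem_edge hm))
  have htest : N.IsTestJK φ i j k := by
    refine ⟨hφc, (hder j hj).differentiableWithinAt, (hder k hk).differentiableWithinAt, ?_⟩
    rw [hpd j hj, hpd k hk, hej, hek]
    linear_combination c * sgn_mul_self i j - c * sgn_mul_self i k
  have hval : ∀ m ∈ N.Inc i, ∀ x ∈ N.edge m, |x - N.param i m| < N.l m / 2 →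
      φ m x = e m * |x - N.param i m| := fun m hm x hx hxl => by
    simp only [hφ, min_eq_abs_sub_param hm hx hxl]
  have hval0 : ∀ m ∈ N.Inc i, φ m (N.param i m) = 0 := fun m hm => by
    rw [hval m hm _ (param_mem_edge hm) (by simpa using N.l_pos m)]
    simp
  have hloc : N.LocalMaxVertex (fun m x => u m x - φ m x) i j k := by
    refine ⟨min (min η₁ η₂) (min (N.l j / 2) (N.l k / 2)), by positivity, ?_, ?_⟩ <;>
    · intro x hx hxl
      simp only [lt_min_iff] at hxl
      obtain ⟨⟨hx1, hx2⟩, hx3, hx4⟩ := hxl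
      dsimp only
      first
      | have h := hJ _ (abs_sub_param_mem hj hx) hx1
        rw [out_abs_sub_param hj hx, out_zero] at h
        rw [hval0 j hj, hval j hj x hx hx3, hej]
        linarith
      | have h := hK _ (abs_sub_param_mem hk hx) hx2
        rw [out_abs_sub_param hk hx, out_zero] at h
        rw [hval0 k hk, hval k hk x hx hx4, hek]
        linarith
  have := hu.2.2 i hi j hj k hk hjk φ htest hloc
  rw [hpd j hj, hej, mul_comm] at this
  simpa [edgeH] using this

/-- The supersolution condition at a transition vertex, for constant test functions. -/
lemma IsSupersol.vertex (hu : N.IsSupersol H u) (hi : i ∈ N.IT) (hj : j ∈ N.Inc i)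
    (h : ∀ k ∈ N.Inc i, ∃ η > 0, ∀ t ∈ Icc 0 (N.l k), t < η →
      u k (N.out i k 0) ≤ u k (N.out i k t)) :
    0 ≤ edgeH H i j 0 (u j (N.out i j 0)) 0 := by
  obtain ⟨k, hk, -, htest⟩ := hu.2.2 i hi j hj
  obtain ⟨η₁, hη₁, hJ⟩ := h j hj
  obtain ⟨η₂, hη₂, hK⟩ := h k hk
  have hpd : ∀ m x, N.pd (fun _ _ => 0) m x = 0 := fun m x => by simp [pd]
  have := htest (fun _ _ => 0)
    ⟨isCont_of_vanish (fun _ => continuousOn_const) (fun _ => rfl) (fun _ => rfl),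
      differentiableWithinAt_const _, differentiableWithinAt_const _, by simp [hpd]⟩
    ⟨min η₁ η₂, lt_min hη₁ hη₂, fun x hx hxl => ?_, fun x hx hxl => ?_⟩
  · simpa [edgeH, hpd] using this
  · have h := hJ _ (abs_sub_param_mem hj hx) (hxl.trans_le (min_le_left _ _))
    rw [out_abs_sub_param hj hx, out_zero] at h
    simpa using h
  · have h := hK _ (abs_sub_param_mem hk hx) (hxl.trans_le (min_le_right _ _))
    rw [out_abs_sub_param hk hx, out_zero] at h
    simpa using h

lemma edgeH_zero_eq (hH5 : N.H5 H) (hH6 : N.H6 H) (hi : i ∈ N.IT) (hj : j ∈ N.Inc i)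
    (hk : k ∈ N.Inc i) (r p : ℝ) : edgeH H i j 0 r p = H k (N.param i k) r p := by
  rw [edgeH, out_zero, ← hH5 i hi j hj k hk]
  rcases sgn_param_cases hj with ⟨h, -⟩ | ⟨h, -⟩ <;> rw [h]
  · rw [one_mul]
  · rw [neg_one_mul, ← hH6 i hi j hj]

lemma H0.continuous_param (hH0 : N.H0 H) (hj : j ∈ N.Inc i) :
    Continuous fun q : ℝ × ℝ => H j (N.param i j) q.1 q.2 := by
  rw [← continuousOn_univ]
  exact (hH0 j).comp (g := fun q : ℝ × ℝ × ℝ => H j q.1 q.2.1 q.2.2)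
    (f := fun q : ℝ × ℝ => (N.param i j, q.1, q.2)) (Continuous.continuousOn (by fun_prop))
    fun q _ => ⟨param_mem_edge hj, trivial, trivial⟩

/-- At a transition vertex the Hamiltonian is nondecreasing in `|p|`. -/
lemma le_of_abs_le (hH0 : N.H0 H) (hH3 : N.H3 H) (hH6 : N.H6 H) (hi : i ∈ N.IT)
    (hj : j ∈ N.Inc i) (r : ℝ) {p q : ℝ} (hpq : |p| ≤ |q|) :
    H j (N.param i j) r p ≤ H j (N.param i j) r q := by
  have habs : ∀ p, H j (N.param i j) r p = H j (N.param i j) r |p| := by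
    intro p
    rcases abs_choice p with h | h <;> rw [h]
    exact hH6 i hi j hj r p
  rw [habs p, habs q]
  rcases (abs_nonneg p).eq_or_lt with hp | hp
  · rw [← hp]
    rcases (abs_nonneg q).eq_or_lt with hq | hq
    · rw [← hq]
    · have hc : Continuous fun p => H j (N.param i j) r p :=
        (hH0.continuous_param hj).comp (by fun_prop : Continuous fun p : ℝ => (r, p))
      refine le_of_tendsto ((hc.tendsto 0).mono_left (nhdsWithin_le_nhds (s := Ioi 0))) ?_
      filter_upwards [Ioc_mem_nhdsGT hq] with x hx
      exact hH3 i hi j hj r hx.1 hq hx.2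
  · exact hH3 i hi j hj r hp (hp.trans_le hpq) hpq

/-- At a transition vertex where the Hamiltonian is nonpositive for `(r₂,0)`, the sublevel sets
for `r₁ < r₂` are strictly larger than the one for `r₂`. -/
lemma exists_separating_slopes (hH0 : N.H0 H) (hH3 : N.H3 H) (hH4 : N.H4 H) (hH6 : N.H6 H)
    (hi : i ∈ N.IT) (hj : j ∈ N.Inc i)
    (hHr : ∀ p : ℝ, StrictMono fun r => H j (N.param i j) r p) {r₁ r₂ : ℝ} (hr : r₁ < r₂)
    (h0 : H j (N.param i j) r₂ 0 ≤ 0) :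
    ∃ a L : ℝ, 0 ≤ a ∧ a < L ∧ (∀ p, a < |p| → 0 < H j (N.param i j) r₂ p) ∧
      ∀ p, |p| ≤ L → H j (N.param i j) r₁ p < 0 := by
  have hc : ∀ r, Continuous fun p => H j (N.param i j) r p := fun r =>
    (hH0.continuous_param hj).comp (by fun_prop : Continuous fun p : ℝ => (r, p))
  set S : Set ℝ := {p | 0 ≤ p ∧ H j (N.param i j) r₂ p ≤ 0} with hS
  obtain ⟨M, hM⟩ := hH4 j (|r₂| + 1) (by positivity) 0
  have hSc : IsClosed S := isClosed_Ici.inter (isClosed_le (hc r₂) continuous_const)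
  have hSb : BddAbove S := by
    refine ⟨M, fun p hp => le_of_not_gt fun hlt => ?_⟩
    have := hM _ (param_mem_edge hj) r₂ (by linarith) p (hlt.trans_le (le_abs_self p))
    linarith [hp.2]
  have hSn : S.Nonempty := ⟨0, le_rfl, h0⟩
  have hmem : sSup S ∈ S := hSc.csSup_mem hSn hSb
  have hneg : H j (N.param i j) r₁ (sSup S) < 0 := (hHr _ hr).trans_le hmem.2
  obtain ⟨ε, hε, hb⟩ := Metric.eventually_nhds_iff.1
    (((hc r₁).tendsto (sSup S)).eventually (gt_mem_nhds hneg))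
  refine ⟨sSup S, sSup S + ε / 2, hmem.1, by linarith, fun p hp => ?_, fun p hp => ?_⟩
  · by_contra! hle
    have : |p| ∈ S := ⟨abs_nonneg p, (le_of_abs_le hH0 hH3 hH6 hi hj r₂ (abs_abs p).le).trans hle⟩
    exact absurd (le_csSup hSb this) (not_le.2 hp)
  · refine (le_of_abs_le hH0 hH3 hH6 hi hj r₁ (hp.trans (le_abs_self _))).trans_lt (hb ?_)
    rw [Real.dist_eq, add_sub_cancel_left, abs_of_pos (by positivity)]
    linarith

/-- The difference of a subsolution and a supersolution has no positive local maximum at a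
transition vertex. -/
lemma not_vertex_max (hH0 : N.H0 H) (hH3 : N.H3 H) (hH4 : N.H4 H) (hH5 : N.H5 H) (hH6 : N.H6 H)
    (hHr : ∀ j, ∀ y ∈ N.edge j, ∀ p : ℝ, StrictMono fun r => H j y r p)
    {u₁ u₂ : N.J → ℝ → ℝ} {B : ℝ} (hb₂ : ∀ j, ∀ x ∈ N.edge j, |u₂ j x| ≤ B)
    (hsup : N.IsSupersol H u₁) (hsub : N.IsSubsol H u₂) (hi : i ∈ N.IT) (hj : j ∈ N.Inc i)
    (hlt : u₁ j (N.param i j) < u₂ j (N.param i j))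
    (hmax : ∀ k ∈ N.Inc i, ∀ x ∈ N.edge k,
      u₂ k x - u₁ k x ≤ u₂ k (N.param i k) - u₁ k (N.param i k)) : False := by
  set r₁ := u₁ j (N.param i j) with hr₁
  set r₂ := u₂ j (N.param i j) with hr₂
  have hv₁ : ∀ k ∈ N.Inc i, u₁ k (N.out i k 0) = r₁ := fun k hk => by
    rw [out_zero, hsup.1.1 i k hk j hj]
  have hv₂ : ∀ k ∈ N.Inc i, u₂ k (N.out i k 0) = r₂ := fun k hk => by
    rw [out_zero, hsub.1.1 i k hk j hj]
  have hother : ∀ k ∈ N.Inc i, ∃ m ∈ N.Inc i, k ≠ m := fun k hk => by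
    obtain ⟨m, hm, hne, -⟩ := hsup.2.2 i hi k hk
    exact ⟨m, hm, hne.symm⟩
  have hE : ∀ k ∈ N.Inc i, ∀ r p, edgeH H i k 0 r p = H j (N.param i j) r p :=
    fun k hk => edgeH_zero_eq hH5 hH6 hi hk hj
  have hmono := fun r p q => @le_of_abs_le N H i j hH0 hH3 hH6 hi hj r p q
  have hupper : ∀ k ∈ N.Inc i, ∀ c c', (∀ p, c ≤ |p| → 0 < H j (N.param i j) r₂ p) → c < c' →
      ∃ η > 0, ∀ t ∈ Icc 0 (N.l k), t < η →
        u₂ k (N.out i k t) ≤ u₂ k (N.out i k 0) + c' * t := by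
    intro k hk c c' hpos hcc
    refine IsEdgeSubsol.le_linear_near_left (N.l_pos k) (hH0.edgeCont hk) (hH4.edgeCoercive hk)
      (hsub.edgeSubsol hk) (hsub.1.comp_out hk) (B := B)
      (fun t ht => hb₂ k _ (out_mem_edge hk ht)) (fun p hp => ?_) hcc
    rw [hv₂ k hk, hE k hk]
    exact hpos p hp
  have h0 : H j (N.param i j) r₂ 0 ≤ 0 := by
    by_contra! hpos
    have hall : ∀ p, (-1 : ℝ) ≤ |p| → 0 < H j (N.param i j) r₂ p := fun p _ =>
      hpos.trans_le (hmono r₂ 0 p (by simp))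
    obtain ⟨k, hk, hjk⟩ := hother j hj
    have h1 := hupper j hj _ 0 hall (by norm_num)
    have h2 := hupper k hk _ (-0) hall (by norm_num)
    have := hsub.vertex hi hj hk hjk h1 h2
    rw [hv₂ j hj, hE j hj] at this
    linarith
  obtain ⟨a, L, ha, haL, hpos, hneg⟩ :=
    exists_separating_slopes hH0 hH3 hH4 hH6 hi hj (hHr j _ (param_mem_edge hj)) hlt h0
  obtain ⟨c, hac, hcL⟩ := exists_between haL
  obtain ⟨c', hcc', hc'L⟩ := exists_between hcL
  have hmin : ∀ k ∈ N.Inc i, ∃ η > 0, ∀ t ∈ Icc 0 (N.l k), t < η →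
      u₁ k (N.out i k 0) ≤ u₁ k (N.out i k t) := by
    intro k hk
    have hlow : ∃ η > 0, ∀ t ∈ Icc 0 (N.l k), t < η →
        u₂ k (N.out i k 0) - c' * t ≤ u₂ k (N.out i k t) := by
      rcases IsEdgeSubsol.linear_le_or_le_linear_near_left (c := c') (N.l_pos k)
        (hH0.edgeCont hk) (hH4.edgeCoercive hk) (hsub.edgeSubsol hk) (hsub.1.comp_out hk)
        (fun p hp => by
          rw [hv₂ k hk, hE k hk]
          exact hpos p (by linarith)) with h | ⟨η, hη, h⟩
      · exact h
      · obtain ⟨m, hm, hkm⟩ := hother k hk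
        have h1 := hupper m hm c (- -c') (fun p hp => hpos p (by linarith)) (by linarith)
        have := hsub.vertex hi hk hm hkm (c := -c')
          ⟨η, hη, fun t ht htη => by linarith [h t ht htη]⟩ h1
        rw [hv₂ k hk, hE k hk] at this
        have h2 := hpos (-c') (by rw [abs_neg]; exact lt_abs.2 (Or.inl (by linarith)))
        linarith
    refine IsEdgeSupersol.le_near_left (L := L) (a := c') (N.l_pos k) (hH0.edgeCont hk)
      (hsup.edgeSupersol hk) (hsup.1.comp_out hk) (fun p hp => ?_) (by linarith) hc'L ?_
    · rw [hv₁ k hk, hE k hk]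
      exact hneg p hp
    · obtain ⟨η, hη, h⟩ := hlow
      refine ⟨η, hη, fun t ht htη => ?_⟩
      have h1 := hmax k hk _ (out_mem_edge hk ht)
      have h2 := h t ht htη
      rw [out_zero] at h2 ⊢
      linarith
  have := hsup.vertex hi hj hmin
  rw [hv₁ j hj, hE j hj] at this
  have h1 := hneg 0 (by rw [abs_zero]; linarith)
  linarith

lemma exists_max_sub {u₁ u₂ : N.J → ℝ → ℝ} (h₁ : N.IsLSC u₁) (h₂ : N.IsUSC u₂) :
    ∃ j, ∃ x ∈ N.edge j, ∀ k, ∀ y ∈ N.edge k, u₂ k y - u₁ k y ≤ u₂ j x - u₁ j x := by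
  have hedge : ∀ j, ∃ x ∈ N.edge j, ∀ y ∈ N.edge j, u₂ j y - u₁ j y ≤ u₂ j x - u₁ j x := by
    intro j
    have hneg : UpperSemicontinuousOn (fun x => -u₁ j x) (N.edge j) :=
      continuous_neg.comp_lowerSemicontinuousOn_antitone (h₁.2 j) fun a b h => neg_le_neg h
    obtain ⟨x, hx, hmax⟩ := ((h₂.2 j).add hneg).exists_isMaxOn
      (nonempty_Icc.2 (N.l_pos j).le) isCompact_Icc
    refine ⟨x, hx, fun y hy => ?_⟩
    have : u₂ j y + -u₁ j y ≤ u₂ j x + -u₁ j x := hmax hy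
    linarith
  choose x hx hmax using hedge
  obtain ⟨j, hj⟩ := Finite.exists_max fun j => u₂ j (x j) - u₁ j (x j)
  exact ⟨j, x j, hx j, fun k y hy => (hmax k y hy).trans (hj k)⟩

lemma exists_param_eq {x : ℝ} (hx : x ∈ N.edge j) (hx' : x ∉ Ioo 0 (N.l j)) :
    ∃ i, j ∈ N.Inc i ∧ N.param i j = x := by
  rcases hx.1.eq_or_lt with h | h
  · exact ⟨N.s j, Or.inl rfl, by simp [param, ← h]⟩
  · refine ⟨N.t j, Or.inr rfl, ?_⟩
    rw [param, if_neg (N.st_ne j)]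
    by_contra hne
    exact hx' ⟨h, lt_of_le_of_ne hx.2 (Ne.symm hne)⟩

end Network

open Network in
/-- **Theorem 2.9(a)** (comparison principle for viscosity solutions under strict
monotonicity). -/
theorem viscosity_comparison_strict_mono
    (N : Network) (H : N.J → ℝ → ℝ → ℝ → ℝ)
    (hH0 : N.H0 H) (hH1 : N.H1 H) (hH3 : N.H3 H) (hH4 : N.H4 H)
    (hH5 : N.H5 H) (hH6 : N.H6 H)
    (hHr : ∀ j, ∀ y ∈ N.edge j, ∀ p : ℝ, StrictMono fun r => H j y r p)
    (u₁ u₂ : N.J → ℝ → ℝ)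
    (hb₁ : ∃ C : ℝ, ∀ j, ∀ x ∈ N.edge j, |u₁ j x| ≤ C)
    (hb₂ : ∃ C : ℝ, ∀ j, ∀ x ∈ N.edge j, |u₂ j x| ≤ C)
    (hsup : N.IsSupersol H u₁) (hsub : N.IsSubsol H u₂)
    (hbd : ∀ i ∈ N.IB, ∀ j ∈ N.Inc i, u₂ j (N.param i j) ≤ u₁ j (N.param i j)) :
    ∀ j, ∀ x ∈ N.edge j, u₂ j x ≤ u₁ j x := by
  obtain ⟨C₁, hC₁⟩ := hb₁
  obtain ⟨C₂, hC₂⟩ := hb₂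
  have hB₁ : ∀ j, ∀ x ∈ N.edge j, |u₁ j x| ≤ max C₁ C₂ := fun j x hx =>
    (hC₁ j x hx).trans (le_max_left _ _)
  have hB₂ : ∀ j, ∀ x ∈ N.edge j, |u₂ j x| ≤ max C₁ C₂ := fun j x hx =>
    (hC₂ j x hx).trans (le_max_right _ _)
  obtain ⟨j, x, hx, hmax⟩ := exists_max_sub hsup.1 hsub.1
  rcases le_or_gt (u₂ j x) (u₁ j x) with hle | hlt
  · intro k y hy
    linarith [hmax k y hy]
  exfalso
  by_cases hxI : x ∈ Ioo 0 (N.l j)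
  · have hj : j ∈ N.Inc (N.s j) := Or.inl rfl
    have hout : ∀ t, N.out (N.s j) j t = t := fun t => by simp [out, param, sgn]
    refine IsEdgeSubsol.not_interior_max (hH0.edgeCont hj) (hH4.edgeCoercive hj)
      (hsub.edgeSubsol hj) (hsup.edgeSupersol hj) (hsub.1.comp_out hj) (hsup.1.comp_out hj)
      (fun t ht => hB₂ j _ (out_mem_edge hj ht)) (fun t ht => hB₁ j _ (out_mem_edge hj ht))
      hxI (fun t ht => ?_) fun p => ?_
    · simpa only [hout] using hmax j t ht
    · simpa only [edgeH, hout] using hHr j x hx _ hlt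
  · obtain ⟨i, hj, rfl⟩ := exists_param_eq hx hxI
    have hi : i ∈ N.IT := fun hiB => absurd (hbd i hiB j hj) (not_le.2 hlt)
    refine not_vertex_max hH0 hH3 hH4 hH5 hH6 hHr hB₂ hsup hsub hi hj hlt fun k hk y hy => ?_
    rw [hsub.1.1 i k hk j hj, hsup.1.1 i k hk j hj]
    exact hmax k y hy
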